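/- Let K be an algebraically closed field of characteristic 2 and let X = {F = 0} ⊂ ℙ³_K be an irreducible quartic surface with Sing(X) finite, where F(x₁,x₂,x₃,z) = z²·(x₁x₂ + x₃²) + B(x₁,x₂,x₃) with B homogeneous of degree 4 (the inseparable case in which the projectivized tangent cone at the double point P = [0:0:0:1] is a smooth conic). Then |Sing(X)| ≤ 16. -/

import Mathlib

open MvPolynomial

noncomputable section

/-- The singular locus of the surface `{F = 0} ⊆ ℙ³_K`: the set of points of `ℙ³_K` at which
`F` and all four partial derivatives of `F` vanish (tested on every representative vector). -/
def singLocus {K : Type*} [Field K] (F : MvPolynomial (Fin 4) K) :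
    Set (Projectivization K (Fin 4 → K)) :=
  {p | ∀ (v : Fin 4 → K) (hv : v ≠ 0), Projectivization.mk K v hv = p →
      (eval v F = 0 ∧ ∀ i, eval v (pderiv i F) = 0)}

section Helpers
variable {K : Type*} [Field K]

theorem finrank_homog (n : ℕ) :
    Module.finrank K (homogeneousSubmodule (Fin 3) K n) = (n + 2).choose 2 := by
  classical
  have hset : ({d : Fin 3 →₀ ℕ | d.degree = n}) =
      ((Finset.finsuppAntidiag (Finset.univ : Finset (Fin 3)) n : Finset _) : Set (Fin 3 →₀ ℕ)) := by
    ext d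
    simp [Finsupp.degree_eq_sum]
  rw [homogeneousSubmodule_eq_finsupp_supported, hset,
    (AddMonoidAlgebra.supportedEquivFinsupp _).finrank_eq]
  rw [Module.finrank_finsupp_self]
  rw [show ∀ s : Finset (Fin 3 →₀ ℕ), Fintype.card ((s : Set (Fin 3 →₀ ℕ)) : Type) = s.card from
    fun s => by simp, Finset.card_finsuppAntidiag_nat_eq_choose]
  simp
  rw [show 2 + n = n + 2 by ring, Nat.choose_symm_add]

instance finite_homog (n : ℕ) : FiniteDimensional K (homogeneousSubmodule (Fin 3) K n) :=
  Module.Finite.iff_fg.mpr (homogeneousSubmodule_fg _ _ n)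

/-- multiplication by `f` -/
def mulMap (f : MvPolynomial (Fin 3) K) (n : ℕ) : Submodule K (MvPolynomial (Fin 3) K) :=
  (homogeneousSubmodule (Fin 3) K n).map (LinearMap.mulLeft K f)

theorem finrank_mulMap (f : MvPolynomial (Fin 3) K) (hf : f ≠ 0) (n : ℕ) :
    Module.finrank K (mulMap f n) = (n + 2).choose 2 := by
  rw [← finrank_homog (K := K) n, mulMap]
  exact (Submodule.equivMapOfInjective _ (mul_right_injective₀ hf) _).finrank_eq.symm

instance finite_mulMap (f : MvPolynomial (Fin 3) K) (n : ℕ) : FiniteDimensional K (mulMap f n) := by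
  unfold mulMap; infer_instance

theorem mulMap_le (f : MvPolynomial (Fin 3) K) (m n : ℕ) (hf : f.IsHomogeneous m) :
    mulMap f n ≤ homogeneousSubmodule (Fin 3) K (m + n) := by
  rintro _ ⟨u, hu, rfl⟩
  exact hf.mul hu

theorem mulMap_inf_le (f g : MvPolynomial (Fin 3) K) (m n e : ℕ) (hf : f.IsHomogeneous m)
    (hg : g.IsHomogeneous n) (hfg : IsRelPrime f g) (hg0 : g ≠ 0) :
    mulMap f (n + e) ⊓ mulMap g (m + e) ≤ mulMap (f * g) e := by
  rintro h ⟨⟨u, hu, rfl⟩, ⟨v, hv, hvu⟩⟩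
  simp only [LinearMap.mulLeft_apply, SetLike.mem_coe] at *
  have hd : g ∣ f * u := ⟨v, hvu.symm⟩
  obtain ⟨w, rfl⟩ := hfg.symm.dvd_of_dvd_mul_left hd
  have hfgw : (f * g * w).IsHomogeneous (m + n + e) := by
    rw [mul_assoc, add_assoc]; exact hf.mul hu
  let _ : GradedAlgebra (homogeneousSubmodule (Fin 3) K) := MvPolynomial.gradedAlgebra
  have := DirectSum.coe_decompose_mul_add_of_left_mem (homogeneousSubmodule (Fin 3) K)
    (j := e) (b := w) (hf.mul hg)
  rw [DirectSum.decompose_of_mem_same _ hfgw] at this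
  refine ⟨_, (DirectSum.decompose (homogeneousSubmodule (Fin 3) K) w e).2, ?_⟩
  rw [LinearMap.mulLeft_apply, ← mul_assoc, this]

/-- a linear form -/
def lin (c : Fin 3 → K) : MvPolynomial (Fin 3) K := C (c 0) * X 0 + C (c 1) * X 1 + C (c 2) * X 2

theorem lin_homog (c : Fin 3 → K) : (lin c).IsHomogeneous 1 :=
  ((isHomogeneous_C_mul_X _ _).add (isHomogeneous_C_mul_X _ _)).add (isHomogeneous_C_mul_X _ _)

@[simp] theorem eval_lin (c v : Fin 3 → K) : eval v (lin c) = c 0 * v 0 + c 1 * v 1 + c 2 * v 2 := by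
  simp [lin]

theorem exists_lin_sep (s t : Fin 3 → K) (ht : t ≠ 0) (h : ∀ c : K, s ≠ c • t) :
    ∃ c, eval t (lin c) = 0 ∧ eval s (lin c) ≠ 0 := by
  by_contra! H
  have h1 := H ![t 1, - t 0, 0] (by simp; ring)
  have h2 := H ![t 2, 0, - t 0] (by simp; ring)
  have h3 := H ![0, t 2, - t 1] (by simp; ring)
  simp at h1 h2 h3
  obtain ⟨i, hi⟩ := Function.ne_iff.mp ht
  apply h (s i / t i)
  ext j
  simp only [Pi.smul_apply, smul_eq_mul]
  simp at hi
  field_simp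
  fin_cases i <;> fin_cases j <;> simp <;> grind

theorem exists_lin_ne (s : Fin 3 → K) (hs : s ≠ 0) : ∃ c, eval s (lin c) ≠ 0 := by
  obtain ⟨i, hi⟩ := Function.ne_iff.mp hs
  refine ⟨Pi.single i 1, ?_⟩
  fin_cases i <;> simpa using hi

theorem bezout (f g : MvPolynomial (Fin 3) K) (hf : f.IsHomogeneous 3)
    (hg : g.IsHomogeneous 5) (hfg : IsRelPrime f g) (hf0 : f ≠ 0) (hg0 : g ≠ 0)
    (T : Finset (Fin 3 → K)) (hT0 : ∀ t ∈ T, t ≠ 0)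
    (hT : ∀ s ∈ T, ∀ t ∈ T, ∀ c : K, s = c • t → s = t)
    (hTf : ∀ t ∈ T, eval t f = 0) (hTg : ∀ t ∈ T, eval t g = 0) : T.card ≤ 15 := by
  classical
  set e := T.card with he
  set S := homogeneousSubmodule (Fin 3) K (8 + e) with hS
  set I := mulMap f (5 + e) ⊔ mulMap g (3 + e) with hI
  have hIS : I ≤ S := by
    refine sup_le ?_ ?_
    · have := mulMap_le f 3 (5 + e) hf
      rwa [show 3 + (5 + e) = 8 + e by ring] at this
    · have := mulMap_le g 5 (3 + e) hg
      rwa [show 5 + (3 + e) = 8 + e by ring] at this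
  have hr1 := Submodule.finrank_sup_add_finrank_inf_eq (mulMap f (5 + e)) (mulMap g (3 + e))
  have hr2 := Submodule.finrank_mono (mulMap_inf_le f g 3 5 e hf hg hfg hg0)
  rw [finrank_mulMap _ (mul_ne_zero hf0 hg0)] at hr2
  rw [finrank_mulMap _ hf0, finrank_mulMap _ hg0] at hr1
  let ev : MvPolynomial (Fin 3) K →ₗ[K] (T → K) :=
    LinearMap.pi fun t => (aeval (t : Fin 3 → K)).toLinearMap
  have hev : ∀ p t, ev p t = eval (t : Fin 3 → K) p := by
    intro p t; simp [ev, aeval_eq_eval]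
  let ev' : S →ₗ[K] (T → K) := ev.comp S.subtype
  have hsurj : LinearMap.range ev' = ⊤ := by
    rw [eq_top_iff, ← (Pi.basisFun K T).span_eq, Submodule.span_le]
    rintro _ ⟨s, rfl⟩
    obtain ⟨c0, hc0⟩ := exists_lin_ne s.1 (hT0 _ s.2)
    have : ∀ t : Fin 3 → K, ∃ c, (t ∈ T.erase s.1 → eval t (lin c) = 0) ∧ eval s.1 (lin c) ≠ 0 := by
      intro t
      by_cases ht : t ∈ T.erase s.1
      · obtain ⟨h1, h2⟩ := Finset.mem_erase.mp ht
        obtain ⟨c, hc⟩ := exists_lin_sep s.1 t (hT0 _ h2)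
          (fun c hc => h1 (hT _ s.2 _ h2 c hc).symm)
        exact ⟨c, fun _ => hc.1, hc.2⟩
      · exact ⟨c0, fun h => absurd h ht, hc0⟩
    choose c hc hc' using this
    let p := (lin c0) ^ 9 * ∏ t ∈ T.erase s.1, lin (c t)
    have hp : p.IsHomogeneous (8 + e) := by
      have h1 := (lin_homog c0).pow 9
      have h2 := IsHomogeneous.prod (T.erase s.1) (fun t => lin (c t)) (fun _ => 1)
        (fun t _ => lin_homog _)
      have h3 := h1.mul h2
      convert h3 using 1
      have := Finset.card_pos.mpr ⟨_, s.2⟩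
      simp [Finset.card_erase_of_mem s.2]
      omega
    have hps : eval s.1 p ≠ 0 := by
      simp only [p, map_mul, map_pow, map_prod]
      exact mul_ne_zero (pow_ne_zero _ hc0) (Finset.prod_ne_zero_iff.mpr fun t _ => hc' t)
    refine ⟨(eval s.1 p)⁻¹ • ⟨p, hp⟩, ?_⟩
    ext t
    rw [map_smul, Pi.smul_apply, Pi.basisFun_apply]
    change _ • ev p t = _
    rw [hev]
    by_cases hts : t = s
    · subst hts; simp [hps]
    · have : eval t.1 p = 0 := by
        have ht : t.1 ∈ T.erase s.1 := Finset.mem_erase.mpr ⟨fun h => hts (Subtype.ext h), t.2⟩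
        simp only [p, map_mul, map_pow, map_prod]
        rw [Finset.prod_eq_zero ht (hc _ ht), mul_zero]
      simp [this, hts]
  have hker : Module.finrank K I ≤ Module.finrank K (LinearMap.ker ev') := by
    let φ : I →ₗ[K] LinearMap.ker ev' :=
      LinearMap.codRestrict _ (Submodule.inclusion hIS) (by
        rintro ⟨x, hx⟩
        rw [LinearMap.mem_ker]
        change ev x = 0
        have : I ≤ LinearMap.ker ev := by
          refine sup_le ?_ ?_
          · rintro _ ⟨u, _, rfl⟩
            rw [LinearMap.mem_ker]; ext t
            rw [hev]; simp [hTf _ t.2]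
          · rintro _ ⟨u, _, rfl⟩
            rw [LinearMap.mem_ker]; ext t
            rw [hev]; simp [hTg _ t.2]
        exact this hx)
    apply LinearMap.finrank_le_finrank_of_injective (f := φ)
    intro a b hab
    apply Submodule.inclusion_injective hIS
    exact congrArg Subtype.val hab
  have hrn := LinearMap.finrank_range_add_finrank_ker ev'
  rw [hsurj, finrank_top, Module.finrank_fintype_fun_eq_card, Fintype.card_coe, finrank_homog] at hrn
  rw [← hI] at hr1
  have key : ∀ n : ℕ, 2 * (n + 2).choose 2 = (n + 2) * (n + 1) := by
    intro n
    rw [Nat.choose_two_right, Nat.mul_div_cancel' (Nat.even_mul_pred_self _).two_dvd]; rfl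
  have k1 := key (8 + e)
  have k2 := key (5 + e)
  have k3 := key (3 + e)
  have k4 := key e
  have : 2 * e ≤ 30 := by nlinarith
  omega

theorem not_dvd_both (D : MvPolynomial (Fin 3) K) (hD : Irreducible D) (c d : Fin 3 → K)
    (hc : D ∣ lin c) (hd : D ∣ lin d) (s t : Fin 3 → K)
    (hs : eval s (lin c) ≠ 0) (hs' : eval s (lin d) = 0) (ht : eval t (lin d) ≠ 0) : False := by
  have aux : ∀ c s, D ∣ lin c → eval s (lin c) ≠ 0 → ∃ k : K, k ≠ 0 ∧ lin c = D * C k := by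
    intro c s hc hs
    have h0 : lin c ≠ 0 := fun h => hs (by rw [h]; simp)
    obtain ⟨u, hu⟩ := hc
    have hD0 := hD.ne_zero
    have hu0 : u ≠ 0 := by rintro rfl; simp at hu; exact h0 hu
    have h1 := (lin_homog c).totalDegree h0
    rw [hu, totalDegree_mul_of_isDomain hD0 hu0] at h1
    have hDd : D.totalDegree ≠ 0 := by
      intro h
      rw [totalDegree_eq_zero_iff_eq_C] at h
      apply hD.not_isUnit
      rw [h]
      refine (IsUnit.mk0 _ ?_).map C
      intro h'; rw [h'] at h; simp at h; exact hD0 h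
    have : u.totalDegree = 0 := by omega
    rw [totalDegree_eq_zero_iff_eq_C] at this
    refine ⟨coeff 0 u, ?_, by rw [← this]; exact hu⟩
    intro h'; rw [h'] at this; simp at this; exact hu0 this
  obtain ⟨k, hk, h1⟩ := aux c s hc hs
  obtain ⟨l, hl, h2⟩ := aux d t hd ht
  rw [h1] at hs
  rw [h2] at hs'
  simp [hk, hl] at hs hs'
  exact hs hs'

theorem exists_lin_not_dvd (D : MvPolynomial (Fin 3) K) (hD : Irreducible D) (t : Fin 3 → K) :
    ∃ c, eval t (lin c) = 0 ∧ ¬ D ∣ lin c := by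
  by_contra! H
  have h1 := H ![t 1, - t 0, 0] (by simp; ring)
  have h2 := H ![t 2, 0, - t 0] (by simp; ring)
  have h3 := H ![0, t 2, - t 1] (by simp; ring)
  by_cases h0 : t 0 = 0
  · by_cases h1' : t 1 = 0
    · by_cases h2' : t 2 = 0
      · have ht : t = 0 := by ext i; fin_cases i <;> simpa
        have a := H ![1, 0, 0] (by rw [ht, eval_lin]; simp)
        have b := H ![0, 1, 0] (by rw [ht, eval_lin]; simp)
        exact not_dvd_both D hD _ _ a b ![1, 0, 0] ![0, 1, 0] (by simp) (by simp) (by simp)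
      · exact not_dvd_both D hD _ _ h2 h3 ![1, 0, 0] ![0, 1, 0] (by simpa) (by simp) (by simpa)
    · exact not_dvd_both D hD _ _ h1 h3 ![1, 0, 0] ![0, 0, 1] (by simpa) (by simp) (by simpa)
  · exact not_dvd_both D hD _ _ h1 h2 ![0, 1, 0] ![0, 0, 1] (by simpa) (by simp) (by simpa)

theorem exists_point [IsAlgClosed K] (D l : MvPolynomial (Fin 3) K) (hD : Irreducible D)
    (hl : ¬ D ∣ l) (T : Finset (Fin 3 → K)) :
    ∃ v : Fin 3 → K, v ≠ 0 ∧ eval v D = 0 ∧ eval v l ≠ 0 ∧ ∀ t ∈ T, ∀ c : K, v ≠ c • t := by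
  have hP : Prime D := hD.prime
  choose h hh hDh using exists_lin_not_dvd D hD
  by_contra! H
  have hvan : l * (lin (h 0) * ∏ t ∈ T, lin (h t)) ∈
      vanishingIdeal K (zeroLocus K (Ideal.span {D})) := by
    rw [mem_vanishingIdeal_iff]
    intro v hv
    rw [zeroLocus_span] at hv
    have hv' : eval v D = 0 := by simpa [aeval_eq_eval] using hv
    simp only [aeval_eq_eval, map_mul, map_prod] 
    by_cases hv0 : v = 0
    · subst hv0
      rw [hh 0]; ring
    by_cases hlv : eval v l = 0
    · rw [hlv, zero_mul]
    obtain ⟨t, ht, c, hc⟩ := H v hv0 hv' hlv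
    suffices hs : eval v (lin (h t)) = 0 by
      rw [Finset.prod_eq_zero ht hs]; ring
    have := hh t
    rw [hc]
    simp at this ⊢
    linear_combination c * this
  rw [vanishingIdeal_zeroLocus_eq_radical] at hvan
  obtain ⟨n, hn⟩ := hvan
  rw [Ideal.mem_span_singleton] at hn
  have := hP.dvd_of_dvd_pow hn
  rcases hP.dvd_or_dvd this with h1 | h1
  · exact hl h1
  rcases hP.dvd_or_dvd h1 with h1 | h1
  · exact hDh _ h1
  · obtain ⟨t, _, ht⟩ := (Prime.dvd_finsetProd_iff hP _).mp h1
    exact hDh _ ht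

theorem homog_eval_smul {n m : ℕ} (p : MvPolynomial (Fin n) K) (hp : p.IsHomogeneous m) (a : K)
    (v : Fin n → K) : eval (a • v) p = a ^ m * eval v p := by
  rw [eval_eq', eval_eq', Finset.mul_sum]
  refine Finset.sum_congr rfl fun d hd => ?_
  have h : d.degree = m := by
    by_contra h
    exact (mem_support_iff.mp hd) (hp.coeff_eq_zero h)
  rw [Finsupp.degree_eq_sum] at h
  simp only [Pi.smul_apply, smul_eq_mul, mul_pow, Finset.prod_mul_distrib, Finset.prod_pow_eq_pow_sum]
  rw [h]; ring

/-- projection away from the last coordinate -/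
def pr3 (w : Fin 4 → K) : Fin 3 → K := w ∘ Fin.castLE (by norm_num : (3:ℕ) ≤ 4)

/-- equations of a singular point lying over `v` with last coordinate `z` -/
def Good (B : MvPolynomial (Fin 3) K) (v : Fin 3 → K) (z : K) : Prop :=
  z ^ 2 * v 1 = eval v (pderiv 0 B) ∧ z ^ 2 * v 0 = eval v (pderiv 1 B) ∧
    eval v (pderiv 2 B) = 0 ∧ z ^ 2 * (v 0 * v 1 + v 2 ^ 2) = eval v B

theorem sing_iff [CharP K 2] (B : MvPolynomial (Fin 3) K) (F : MvPolynomial (Fin 4) K)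
    (hF : F = X 3 ^ 2 * (X 0 * X 1 + X 2 ^ 2)
        + rename (Fin.castLE (by norm_num : (3:ℕ) ≤ 4)) B) (w : Fin 4 → K) :
    (eval w F = 0 ∧ ∀ i, eval w (pderiv i F) = 0) ↔ Good B (pr3 w) (w 3) := by
  have hinj : Function.Injective (Fin.castLE (by norm_num : (3:ℕ) ≤ 4)) :=
    Fin.castLE_injective _
  have h0 := pderiv_rename hinj (x := 0) B
  have h1 := pderiv_rename hinj (x := 1) B
  have h2 := pderiv_rename hinj (x := 2) B
  have h3 : pderiv 3 (rename (Fin.castLE (by norm_num : (3:ℕ) ≤ 4)) B) = 0 := by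
    apply pderiv_eq_zero_of_notMem_vars
    classical
    intro h
    obtain ⟨i, _, hi⟩ := Finset.mem_image.mp (vars_rename _ _ h)
    have := congrArg Fin.val hi
    have := i.2
    simp at *
    omega
  have e0 : Fin.castLE (by norm_num : (3:ℕ) ≤ 4) 0 = 0 := rfl
  have e1 : Fin.castLE (by norm_num : (3:ℕ) ≤ 4) 1 = 1 := rfl
  have e2 : Fin.castLE (by norm_num : (3:ℕ) ≤ 4) 2 = 2 := rfl
  rw [e0] at h0
  rw [e1] at h1
  rw [e2] at h2
  have two : (2 : K) = 0 := CharTwo.two_eq_zero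
  have a0 : pr3 w 0 = w 0 := rfl
  have a1 : pr3 w 1 = w 1 := rfl
  have a2 : pr3 w 2 = w 2 := rfl
  have f : eval w F = w 3 ^ 2 * (w 0 * w 1 + w 2 ^ 2) + eval (pr3 w) B := by
    rw [hF]; simp [eval_rename, pr3]
  have f0 : eval w (pderiv 0 F) = w 3 ^ 2 * w 1 + eval (pr3 w) (pderiv 0 B) := by
    rw [hF, map_add, h0]; simp [eval_rename, pr3, pderiv_X, Derivation.leibniz_pow]
  have f1 : eval w (pderiv 1 F) = w 3 ^ 2 * w 0 + eval (pr3 w) (pderiv 1 B) := by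
    rw [hF, map_add, h1]; simp [eval_rename, pr3, pderiv_X, Derivation.leibniz_pow]
  have f2 : eval w (pderiv 2 F) = eval (pr3 w) (pderiv 2 B) := by
    rw [hF, map_add, h2]; simp [eval_rename, pr3, pderiv_X, Derivation.leibniz_pow, two]
  have f3 : eval w (pderiv 3 F) = 0 := by
    rw [hF, map_add, h3]; simp [pderiv_X, Derivation.leibniz_pow, two]
  simp only [Fin.forall_fin_succ, Good, a0, a1, a2]
  simp only [Fin.isValue, Fin.succ_zero_eq_one, Fin.succ_one_eq_two, f, f0, f1, f2,
    show (Fin.succ 2 : Fin 4) = 3 from rfl, f3, CharTwo.add_eq_zero]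
  simp
  tauto

theorem F_homog (B : MvPolynomial (Fin 3) K) (hB : B.IsHomogeneous 4) (F : MvPolynomial (Fin 4) K)
    (hF : F = X 3 ^ 2 * (X 0 * X 1 + X 2 ^ 2)
        + rename (Fin.castLE (by norm_num : (3:ℕ) ≤ 4)) B) : F.IsHomogeneous 4 := by
  rw [hF]
  refine IsHomogeneous.add ?_ hB.rename_isHomogeneous
  exact (isHomogeneous_X_pow 3 2).mul
    (((isHomogeneous_X K 0).mul (isHomogeneous_X K 1)).add (isHomogeneous_X_pow 2 2))

theorem euler_two [CharP K 2] (B : MvPolynomial (Fin 3) K) (hB : B.IsHomogeneous 4) :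
    X 0 * pderiv 0 B + X 1 * pderiv 1 B + X 2 * pderiv 2 B = 0 := by
  have := hB.sum_X_mul_pderiv
  rw [Fin.sum_univ_three] at this
  rw [this, nsmul_eq_mul]
  have : ((4 : ℕ) : MvPolynomial (Fin 3) K) = 0 := by
    have : (2 : MvPolynomial (Fin 3) K) = 0 := CharTwo.two_eq_zero
    push_cast
    linear_combination 2 * this
  rw [this, zero_mul]

theorem Good.unique [CharP K 2] {B : MvPolynomial (Fin 3) K} {v : Fin 3 → K} {z z' : K}
    (hv : v ≠ 0) (h : Good B v z) (h' : Good B v z') : z = z' := by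
  obtain ⟨h1, h2, -, h4⟩ := h
  obtain ⟨h1', h2', -, h4'⟩ := h'
  suffices hz : z ^ 2 = z' ^ 2 by
    have h5 : (z - z') ^ 2 = 0 := by rw [sub_pow_char]; simp [hz]
    exact sub_eq_zero.mp (pow_eq_zero_iff two_ne_zero |>.mp h5)
  by_cases hv0 : v 0 = 0
  · by_cases hv1 : v 1 = 0
    · have hv2 : v 2 ≠ 0 := by
        intro hv2; apply hv; ext i; fin_cases i <;> simpa
      rw [← h4', hv0, hv1] at h4
      simpa [hv2] using h4
    · exact mul_right_cancel₀ hv1 (h1.trans h1'.symm)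
  · exact mul_right_cancel₀ hv0 (h2.trans h2'.symm)

end Helpers

/-- Inseparable case with smooth projectivized tangent conic: `F = z²(x₁x₂ + x₃²) + B(x₁,x₂,x₃)`,
`X` irreducible with finite singular locus, over an algebraically closed field of
characteristic 2.  Then `|Sing(X)| ≤ 16`. -/
theorem inseparable_smooth_conic_singular_count_le_sixteen
    {K : Type*} [Field K] [IsAlgClosed K] [CharP K 2]
    (B : MvPolynomial (Fin 3) K) (hBhom : B.IsHomogeneous 4)
    (F : MvPolynomial (Fin 4) K)
    (hF : F = X 3 ^ 2 * (X 0 * X 1 + X 2 ^ 2)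
        + rename (Fin.castLE (by norm_num : (3:ℕ) ≤ 4)) B)
    (hFirr : Irreducible F) (hfin : (singLocus F).Finite) :
    (singLocus F).ncard ≤ 16 := by
  classical
  have two : (2 : K) = 0 := CharTwo.two_eq_zero
  have hsing : ∀ p ∈ singLocus F, ∀ a : K, a ≠ 0 → Good B (pr3 (a • p.rep)) ((a • p.rep) 3) := by
    intro p hp a ha
    rw [← sing_iff B F hF]
    refine hp (a • p.rep) (smul_ne_zero ha p.rep_nonzero) ?_
    conv_rhs => rw [← p.mk_rep]
    rw [Projectivization.mk_eq_mk_iff']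
    exact ⟨a, rfl⟩
  have hmem : ∀ w : Fin 4 → K, ∀ hw : w ≠ 0, Good B (pr3 w) (w 3) →
      Projectivization.mk K w hw ∈ singLocus F := by
    intro w hw hg v hv hvw
    rw [Projectivization.mk_eq_mk_iff'] at hvw
    obtain ⟨a, rfl⟩ := hvw
    rw [← sing_iff B F hF] at hg
    have hFh := F_homog B hBhom F hF
    refine ⟨?_, fun i => ?_⟩
    · rw [homog_eval_smul F hFh, hg.1, mul_zero]
    · rw [homog_eval_smul _ hFh.pderiv, hg.2 i, mul_zero]
  have hext : ∀ w w' : Fin 4 → K, pr3 w = pr3 w' → w 3 = w' 3 → w = w' := by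
    intro w w' h h3
    ext i
    have h0 := congrFun h 0
    have h1 := congrFun h 1
    have h2 := congrFun h 2
    fin_cases i
    · exact h0
    · exact h1
    · exact h2
    · exact h3
  have hsmul : ∀ (a : K) (w : Fin 4 → K), pr3 (a • w) = a • pr3 w := fun a w => rfl
  set S' := hfin.toFinset.filter (fun p => pr3 p.rep ≠ 0) with hS'
  have hinj : ∀ p ∈ S', ∀ p' ∈ S', ∀ c : K, pr3 p.rep = c • pr3 p'.rep → p = p' := by
    intro p hp p' hp' c hc
    simp only [hS', Finset.mem_filter, Set.Finite.mem_toFinset] at hp hp'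
    have hc0 : c ≠ 0 := by rintro rfl; rw [zero_smul] at hc; exact hp.2 hc
    have g1 := hsing p hp.1 1 one_ne_zero
    have g2 := hsing p' hp'.1 c hc0
    rw [one_smul] at g1
    rw [hsmul, ← hc] at g2
    have hz := g1.unique hp.2 g2
    have hw := hext p.rep (c • p'.rep) hc hz
    rw [← p.mk_rep, ← p'.mk_rep, Projectivization.mk_eq_mk_iff']
    exact ⟨c, hw.symm⟩
  set T := S'.image (fun p => pr3 p.rep) with hT
  have hTS : T.card = S'.card := by
    apply Finset.card_image_of_injOn
    intro p hp p' hp' h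
    exact hinj p hp p' hp' 1 (by rw [one_smul]; exact h)
  have hcard : (singLocus F).ncard ≤ T.card + 1 := by
    rw [hTS, Set.ncard_eq_toFinset_card _ hfin,
      ← Finset.card_filter_add_card_filter_not (fun p => pr3 p.rep ≠ 0)]
    refine Nat.add_le_add_left (Finset.card_le_one.mpr ?_) _
    intro p hp p' hp'
    simp only [Finset.mem_filter, not_not] at hp hp'
    have n1 : p.rep 3 ≠ 0 := fun h => p.rep_nonzero (hext _ 0 (by rw [hp.2]; rfl) h)
    have n2 : p'.rep 3 ≠ 0 := fun h => p'.rep_nonzero (hext _ 0 (by rw [hp'.2]; rfl) h)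
    rw [← p.mk_rep, ← p'.mk_rep, Projectivization.mk_eq_mk_iff']
    refine ⟨p.rep 3 / p'.rep 3, ?_⟩
    apply hext
    · rw [hsmul, hp.2, hp'.2, smul_zero]
    · simp [n2]
  -- a curve of singular points is impossible
  have hinf : ∀ D l : MvPolynomial (Fin 3) K, Irreducible D → ¬ D ∣ l →
      (∀ v : Fin 3 → K, v ≠ 0 → eval v D = 0 → eval v l ≠ 0 → ∃ z, Good B v z) → False := by
    intro D l hD hDl H
    obtain ⟨v, hv0, hvD, hvl, hvT⟩ := exists_point D l hD hDl T
    obtain ⟨z, hz⟩ := H v hv0 hvD hvl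
    let w : Fin 4 → K := ![v 0, v 1, v 2, z]
    have hwv : pr3 w = v := by ext i; fin_cases i <;> rfl
    have hw0 : w ≠ 0 := by
      intro h; apply hv0; rw [← hwv, h]; rfl
    have hp := hmem w hw0 (by rw [hwv]; exact hz)
    obtain ⟨a, ha⟩ := Projectivization.exists_smul_eq_mk_rep K w hw0
    have ha' : pr3 (Projectivization.mk K w hw0).rep = (a : K) • v := by
      rw [← ha, ← hwv]; rfl
    refine hvT _ (Finset.mem_image_of_mem _ (Finset.mem_filter.mpr
      ⟨hfin.mem_toFinset.mpr hp, ?_⟩)) ((a : K)⁻¹) ?_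
    · rw [ha']; exact smul_ne_zero a.ne_zero hv0
    · simp only [ha']; rw [smul_smul, inv_mul_cancel₀ a.ne_zero, one_smul]
  have heul := euler_two B hBhom
  have heul' : ∀ v : Fin 3 → K, v 0 * eval v (pderiv 0 B) + v 1 * eval v (pderiv 1 B)
      + v 2 * eval v (pderiv 2 B) = 0 := by
    intro v
    have := congrArg (eval v) heul
    simpa using this
  have hsqrt : ∀ a : K, ∃ z, z ^ 2 = a := fun a => IsAlgClosed.exists_pow_nat_eq a two_pos
  by_cases hB2 : pderiv 2 B = 0
  · exfalso
    have hd : (X 1 : MvPolynomial (Fin 3) K) ∣ X 0 * pderiv 0 B := by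
      refine ⟨- pderiv 1 B, ?_⟩
      rw [hB2] at heul
      linear_combination heul
    have hX1 : Prime (X 1 : MvPolynomial (Fin 3) K) := X_prime
    obtain ⟨A, hA⟩ : (X 1 : MvPolynomial (Fin 3) K) ∣ pderiv 0 B := by
      rcases hX1.dvd_or_dvd hd with h | h
      · exfalso
        obtain ⟨u, hu⟩ := h
        have := congrArg (eval ![1, 0, 0]) hu
        simp at this
      · exact h
    have hA' : pderiv 1 B = X 0 * A := by
      apply mul_left_cancel₀ hX1.ne_zero
      rw [hB2, hA] at heul
      have h2 : (2 : MvPolynomial (Fin 3) K) = 0 := CharTwo.two_eq_zero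
      linear_combination heul - X 0 * X 1 * A * h2
    set Q := (X 0 * X 1 + X 2 ^ 2) * A + B with hQ
    have hgood : ∀ v : Fin 3 → K, eval v Q = 0 → ∃ z, Good B v z := by
      intro v hv
      obtain ⟨z, hz⟩ := hsqrt (eval v A)
      refine ⟨z, ?_, ?_, ?_, ?_⟩
      · rw [hA, hz]; simp [mul_comm]
      · rw [hA', hz]; simp [mul_comm]
      · rw [hB2]; simp
      · rw [hz]
        simp [hQ] at hv
        rw [CharTwo.add_eq_zero] at hv
        rw [← hv]; ring
    obtain ⟨D, hD, hDQ⟩ : ∃ D : MvPolynomial (Fin 3) K, Irreducible D ∧ D ∣ Q := by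
      by_cases hQ0 : Q = 0
      · exact ⟨X 0, (X_prime (i := 0)).irreducible, by rw [hQ0]; exact dvd_zero _⟩
      · refine WfDvdMonoid.exists_irreducible_factor ?_ hQ0
        intro hu
        have h1 := hu.map (eval (0 : Fin 3 → K))
        have h2 : eval (0 : Fin 3 → K) Q = 0 := by
          have hb : eval (0 : Fin 3 → K) B = 0 := by
            have := homog_eval_smul B hBhom 0 0
            rwa [zero_smul, zero_pow (by norm_num), zero_mul] at this
          rw [hQ, map_add, map_mul, hb]
          simp
        rw [h2] at h1
        exact not_isUnit_zero h1
    refine hinf D 1 hD (fun h => hD.not_isUnit (isUnit_of_dvd_one h)) ?_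
    intro v _ hv _
    apply hgood
    obtain ⟨u, hu⟩ := hDQ
    rw [hu, map_mul, hv, zero_mul]
  · -- choose a tangent line not contained in the cubic
    obtain ⟨v₀, hv₀⟩ : ∃ v, eval v (X 0 * pderiv 2 B) ≠ 0 := by
      by_contra! H
      have : X 0 * pderiv 2 B = 0 := MvPolynomial.funext (fun v => by rw [H v]; simp)
      rcases mul_eq_zero.mp this with h | h
      · exact (X_prime (R := K) (i := (0 : Fin 3))).ne_zero h
      · exact hB2 h
    simp only [map_mul, eval_X] at hv₀
    have hv00 : v₀ 0 ≠ 0 := left_ne_zero_of_mul hv₀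
    have hv01 := right_ne_zero_of_mul hv₀
    set a := v₀ 0
    set b := v₀ 1
    set l : MvPolynomial (Fin 3) K := C a * X 1 + C b * X 0 with hl
    set G := (X 0 * X 1 + X 2 ^ 2) * (C a * pderiv 0 B + C b * pderiv 1 B) + l * B with hG
    have hlB : ¬ l ∣ pderiv 2 B := by
      rintro ⟨u, hu⟩
      apply hv01
      have : eval v₀ l = 0 := by
        simp only [hl, map_add, map_mul, eval_C, eval_X]
        change a * b + b * a = 0
        linear_combination a * b * two
      rw [hu, map_mul, this, zero_mul]
    have hlhom : l.IsHomogeneous 1 :=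
      (isHomogeneous_C_mul_X _ _).add (isHomogeneous_C_mul_X _ _)
    have hGhom : G.IsHomogeneous 5 := by
      have hd0 : (pderiv 0 B).IsHomogeneous 3 := hBhom.pderiv
      have hd1 : (pderiv 1 B).IsHomogeneous 3 := hBhom.pderiv
      have hq : (X 0 * X 1 + X 2 ^ 2 : MvPolynomial (Fin 3) K).IsHomogeneous 2 :=
        ((isHomogeneous_X K 0).mul (isHomogeneous_X K 1)).add (isHomogeneous_X_pow 2 2)
      exact (hq.mul ((hd0.C_mul a).add (hd1.C_mul b))).add (hlhom.mul hBhom)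
    have hfhom : (pderiv 2 B).IsHomogeneous 3 := hBhom.pderiv
    have hl0 : eval (![0, 1, 0] : Fin 3 → K) l ≠ 0 := by simpa [hl] using hv00
    have hcommon : ∀ D, Irreducible D → D ∣ pderiv 2 B → D ∣ G → False := by
      intro D hD hDf hDG
      refine hinf D l hD ?_ ?_
      · intro hDl
        have hlin : l = lin ![b, a, 0] := by
          simp [lin, hl]; ring
        obtain ⟨u, hu⟩ := hDl
        have hl00 : l ≠ 0 := fun h => hl0 (by rw [h]; simp)
        have hu0 : u ≠ 0 := by rintro rfl; simp at hu; exact hl00 hu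
        have hdeg := hlhom.totalDegree hl00
        rw [hu, totalDegree_mul_of_isDomain hD.ne_zero hu0] at hdeg
        have hDd : D.totalDegree ≠ 0 := by
          intro h
          rw [totalDegree_eq_zero_iff_eq_C] at h
          apply hD.not_isUnit
          rw [h]
          refine (IsUnit.mk0 _ ?_).map C
          intro h'; rw [h'] at h; simp at h; exact hD.ne_zero h
        have hud : u.totalDegree = 0 := by omega
        rw [totalDegree_eq_zero_iff_eq_C] at hud
        have huu : IsUnit u := by
          rw [hud]
          refine (IsUnit.mk0 _ ?_).map C
          intro h'; rw [h'] at hud; simp at hud; exact hu0 hud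
        apply hlB
        rw [hu]
        exact huu.mul_right_dvd.mpr hDf
      · intro v _ hvD hvl
        have hvf : eval v (pderiv 2 B) = 0 := by
          obtain ⟨u, hu⟩ := hDf
          rw [hu, map_mul, hvD, zero_mul]
        have hvG : eval v G = 0 := by
          obtain ⟨u, hu⟩ := hDG
          rw [hu, map_mul, hvD, zero_mul]
        have he := heul' v
        rw [hvf] at he
        simp only [hG, hl, map_add, map_mul, eval_C, eval_X, map_pow] at hvG hvl
        obtain ⟨z, hz⟩ := hsqrt ((a * eval v (pderiv 0 B) + b * eval v (pderiv 1 B)) /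
          (a * v 1 + b * v 0))
        have hz' : z ^ 2 * (a * v 1 + b * v 0) =
            a * eval v (pderiv 0 B) + b * eval v (pderiv 1 B) := by
          rw [hz]; field_simp
        refine ⟨z, ?_, ?_, hvf, ?_⟩
        · apply mul_right_cancel₀ hvl
          linear_combination v 1 * hz' - b * he + b * v 1 * eval v (pderiv 1 B) * two
        · apply mul_right_cancel₀ hvl
          linear_combination v 0 * hz' - a * he + a * v 0 * eval v (pderiv 0 B) * two
        · apply mul_right_cancel₀ hvl
          linear_combination (v 0 * v 1 + v 2 ^ 2) * hz' + hvG
            - (a * v 1 + b * v 0) * eval v B * two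
    have hfu : ¬ IsUnit (pderiv 2 B) := by
      intro hu
      have h1 := hu.map (eval (0 : Fin 3 → K))
      have := homog_eval_smul _ hfhom 0 0
      rw [zero_smul] at this
      rw [this] at h1
      simp at h1
    have hG0 : G ≠ 0 := by
      intro h
      obtain ⟨D, hD, hDf⟩ := WfDvdMonoid.exists_irreducible_factor hfu hB2
      exact hcommon D hD hDf (by rw [h]; exact dvd_zero _)
    have hrel : IsRelPrime (pderiv 2 B) G := by
      refine isRelPrime_of_no_nonunits_factors (fun h => hB2 h.1) ?_
      intro z hz hz0 hzf hzG
      obtain ⟨D, hD, hDz⟩ := WfDvdMonoid.exists_irreducible_factor hz hz0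
      exact hcommon D hD (hDz.trans hzf) (hDz.trans hzG)
    have hTgood : ∀ t ∈ T, t ≠ 0 ∧ ∃ z, Good B t z := by
      intro t ht
      obtain ⟨p, hp, rfl⟩ := Finset.mem_image.mp ht
      obtain ⟨hp1, hp2⟩ := Finset.mem_filter.mp hp
      have := hsing p (hfin.mem_toFinset.mp hp1) 1 one_ne_zero
      rw [one_smul] at this
      exact ⟨hp2, _, this⟩
    have := bezout (pderiv 2 B) G hfhom hGhom hrel hB2 hG0 T (fun t ht => (hTgood t ht).1)
      (by
        intro s hs t ht c hc
        obtain ⟨p, hp, rfl⟩ := Finset.mem_image.mp hs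
        obtain ⟨p', hp', rfl⟩ := Finset.mem_image.mp ht
        rw [hinj p hp p' hp' c hc])
      (fun t ht => by obtain ⟨-, z, hz⟩ := hTgood t ht; exact hz.2.2.1)
      (by
        intro t ht
        obtain ⟨-, z, h1, h2, h3, h4⟩ := hTgood t ht
        simp only [hG, hl, map_add, map_mul, eval_C, eval_X, map_pow]
        rw [← h1, ← h2, ← h4]
        linear_combination z ^ 2 * (t 0 * t 1 + t 2 ^ 2) * (a * t 1 + b * t 0) * two)
    omega

end
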